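/- Let N be a positive integer, let p>1, and let ψ:ℤ^N→[0,∞) be bounded with ψ≢0. For β>0 and r∈ℤ⁺ set D(β;r) = sup_{x∈ℤ^N} #(B_x^r ∩ {y : ψ(y) ≥ β}) / #(B_x^r) and D̄(β) = limsup_{r→∞, r∈ℤ⁺} D(β;r). If there exists β>0 with D̄(β)>0, then the life span T₁ of the solution of u_t = Δ_{ℤ^N} u + u^p, u(·,0)=ψ satisfies T₁ ≤ (1/(p-1)) (β D̄(β))^{1-p}. -/

import Mathlib

open Filter Topology Set
open scoped ENNReal Classical

noncomputable section

/-- The graph Laplacian `Δu(x) = (1/μ(x)) ∑_y ω(x,y) (u(y) − u(x))`. -/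
def graphLap {V : Type*} (ω : V → V → ℝ) (μ : V → ℝ) (u : V → ℝ) (x : V) : ℝ :=
  (1 / μ x) * ∑' y, ω x y * (u y - u x)

/-- `(V, ω, μ)` is a locally finite connected weighted graph: `ω` is symmetric and
nonnegative (with `ω x y > 0` exactly for neighbours), there are no loops, every
vertex has finitely many neighbours, `μ > 0`, and the graph is connected. -/
structure IsWeightedGraph {V : Type*} (ω : V → V → ℝ) (μ : V → ℝ) : Prop where
  symm : ∀ x y, ω x y = ω y x
  nonneg : ∀ x y, 0 ≤ ω x y
  loopless : ∀ x, ω x x = 0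
  locallyFinite : ∀ x, {y | 0 < ω x y}.Finite
  measurePos : ∀ x, 0 < μ x
  connected : ∀ x y, Relation.ReflTransGen (fun a b => 0 < ω a b) x y

/-- `D_μ = sup_x m(x)/μ(x) < ∞`, where `m(x) = ∑_{y ∼ x} ω(x,y)`. -/
def DmuFinite {V : Type*} (ω : V → V → ℝ) (μ : V → ℝ) : Prop :=
  ∃ C : ℝ, ∀ x, (∑' y, ω x y) ≤ C * μ x

/-- A solution of `u_t = L u + u^p` on `V × [0,T)` with initial datum `ψ0`:
a nonnegative function, continuous in `t` on `[0,T)` for each fixed `x`,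
bounded on `V × [0,T']` for every `T' < T`, differentiable in `t` on `(0,T)`
and satisfying the equation pointwise there. -/
structure IsHeatSol {V : Type*} (L : (V → ℝ) → V → ℝ) (p : ℝ)
    (ψ0 : V → ℝ) (T : ℝ) (u : V → ℝ → ℝ) : Prop where
  nonneg : ∀ x, ∀ t ∈ Ico (0:ℝ) T, 0 ≤ u x t
  cont : ∀ x, ContinuousOn (u x) (Ico (0:ℝ) T)
  bounded : ∀ T' ∈ Ioo (0:ℝ) T, ∃ C : ℝ, ∀ x, ∀ t ∈ Icc (0:ℝ) T', |u x t| ≤ C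
  eqn : ∀ x, ∀ t ∈ Ioo (0:ℝ) T,
    HasDerivAt (u x) (L (fun y => u y t) x + u x t ^ p) t
  init : ∀ x, u x 0 = ψ0 x

/-- The life span `T_λ`: the supremum (in `ℝ≥0∞`) of all `T > 0` such that the
problem has a solution on `[0,T)`. -/
def lifeSpan {V : Type*} (L : (V → ℝ) → V → ℝ) (p : ℝ) (ψ0 : V → ℝ) : ℝ≥0∞ :=
  ⨆ (T : ℝ) (_ : 0 < T ∧ ∃ u, IsHeatSol L p ψ0 T u), ENNReal.ofReal T

/-- The graph Laplacian of the lattice `ℤ^N`: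
`Δ_{ℤ^N} u(x) = (1/N) ∑_{|y−x|=1} (u(y) − u(x))`. -/
def latLap (N : ℕ) (u : (Fin N → ℤ) → ℝ) (x : Fin N → ℤ) : ℝ :=
  (1 / (N : ℝ)) * ∑ i : Fin N,
    (u (Function.update x i (x i + 1)) + u (Function.update x i (x i - 1)) - 2 * u x)

/-- The ball `B_x^r` in `ℤ^N` for the graph (`ℓ¹`) distance. -/
def latBall (N : ℕ) (x : Fin N → ℤ) (r : ℕ) : Set (Fin N → ℤ) :=
  {y | (∑ i, (x i - y i).natAbs) ≤ r}

/-- `D(β; r) = sup_x #(B_x^r ∩ {ψ ≥ β}) / #(B_x^r)`. -/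
def densityD (N : ℕ) (ψ : (Fin N → ℤ) → ℝ) (β : ℝ) (r : ℕ) : ℝ :=
  ⨆ x : Fin N → ℤ,
    (Nat.card {y | y ∈ latBall N x r ∧ β ≤ ψ y} : ℝ) / (Nat.card (latBall N x r) : ℝ)

/-- `D̄(β) = limsup_{r→∞} D(β; r)`. -/
def densityDbar (N : ℕ) (ψ : (Fin N → ℤ) → ℝ) (β : ℝ) : ℝ :=
  limsup (fun r : ℕ => densityD N ψ β r) atTop

/-- The `ℓ¹` distance on `ℤ^N`. -/
def latDist {N : ℕ} (x y : Fin N → ℤ) : ℕ := ∑ i, (x i - y i).natAbs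

lemma latBall_finite (N : ℕ) (x : Fin N → ℤ) (r : ℕ) : (latBall N x r).Finite := by
  refine (Set.finite_Icc (fun i => x i - r) (fun i => x i + r)).subset ?_
  intro y hy
  have h : ∀ i, (x i - y i).natAbs ≤ r := fun i =>
    (Finset.single_le_sum (f := fun i => (x i - y i).natAbs) (fun _ _ => Nat.zero_le _)
      (Finset.mem_univ i)).trans hy
  constructor <;> intro i <;> have := h i <;> simp only <;> omega

/-- The ball `B_x^r` as a finite set. -/
def latBallFinset (N : ℕ) (x : Fin N → ℤ) (r : ℕ) : Finset (Fin N → ℤ) :=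
  (latBall_finite N x r).toFinset

lemma mem_latBallFinset {N : ℕ} {x y : Fin N → ℤ} {r : ℕ} :
    y ∈ latBallFinset N x r ↔ latDist x y ≤ r := by
  simp [latBallFinset, latBall, latDist]

/-- The sphere of radius `r` around `x`. -/
def latSphere (N : ℕ) (x : Fin N → ℤ) (r : ℕ) : Finset (Fin N → ℤ) :=
  (latBallFinset N x r).filter fun y => latDist x y = r

lemma mem_latSphere {N : ℕ} {x y : Fin N → ℤ} {r : ℕ} :
    y ∈ latSphere N x r ↔ latDist x y = r := by
  simp only [latSphere, Finset.mem_filter, mem_latBallFinset]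
  omega

lemma card_latBallFinset_pos (N : ℕ) (x : Fin N → ℤ) (r : ℕ) :
    0 < (latBallFinset N x r).card :=
  Finset.card_pos.2 ⟨x, mem_latBallFinset.2 (by simp [latDist])⟩

lemma latDist_update {N : ℕ} (x y : Fin N → ℤ) (i : Fin N) (c : ℤ) :
    latDist x (Function.update y i c) + (x i - y i).natAbs
      = latDist x y + (x i - c).natAbs := by
  unfold latDist
  rw [← Finset.add_sum_erase _ _ (Finset.mem_univ i),
    ← Finset.add_sum_erase Finset.univ (fun j => (x j - y j).natAbs) (Finset.mem_univ i)]
  have : ∑ j ∈ Finset.univ.erase i, (x j - Function.update y i c j).natAbs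
      = ∑ j ∈ Finset.univ.erase i, (x j - y j).natAbs :=
    Finset.sum_congr rfl fun j hj => by
      rw [Function.update_of_ne (Finset.ne_of_mem_erase hj)]
  rw [this, Function.update_self]
  ring

lemma exists_div_le_natAbs {N : ℕ} (hN : 0 < N) (x y : Fin N → ℤ) :
    ∃ i, latDist x y / N ≤ (x i - y i).natAbs := by
  by_contra! h
  have : Nonempty (Fin N) := ⟨⟨0, hN⟩⟩
  have h1 : latDist x y < ∑ _i : Fin N, latDist x y / N :=
    Finset.sum_lt_sum_of_nonempty Finset.univ_nonempty fun i _ => h i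
  rw [Finset.sum_const, Finset.card_univ, Fintype.card_fin, smul_eq_mul] at h1
  exact absurd h1 (not_lt.2 (Nat.mul_div_le _ _))

/-- Spheres are small compared with balls: each point of the sphere can be moved inwards
along a longest coordinate. -/
lemma card_latSphere_mul_le {N : ℕ} (hN : 0 < N) (x : Fin N → ℤ) (r : ℕ) :
    (latSphere N x r).card * (r / N) ≤ N * (latBallFinset N x r).card := by
  choose i hi using fun y => exists_div_le_natAbs hN x y
  let c : (Fin N → ℤ) → ℕ → ℤ := fun y j => if x (i y) ≤ y (i y) then y (i y) - j else y (i y) + j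
  have hd : ∀ y ∈ latSphere N x r, ∀ j < r / N,
      latDist x (Function.update y (i y) (c y j)) + j = r := by
    intro y hy j hj
    rw [mem_latSphere] at hy
    have h1 := latDist_update x y (i y) (c y j)
    have h2 := hi y
    rw [hy] at h1 h2
    simp only [c] at h1 ⊢
    split_ifs at h1 ⊢ <;> omega
  have key := Finset.card_le_card_of_injOn
    (s := latSphere N x r ×ˢ Finset.range (r / N))
    (t := (Finset.univ : Finset (Fin N)) ×ˢ latBallFinset N x r)
    (fun q => (i q.1, Function.update q.1 (i q.1) (c q.1 q.2))) ?_ ?_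
  · simpa [Finset.card_product] using key
  · rintro ⟨y, j⟩ h
    simp only [Finset.coe_product, Set.mem_prod, Finset.mem_coe, Finset.mem_range] at h
    have := hd y h.1 j h.2
    simp only [Finset.coe_product, Set.mem_prod, Finset.mem_coe, Finset.mem_univ, true_and,
      mem_latBallFinset]
    omega
  · rintro ⟨y, j⟩ h ⟨y', j'⟩ h' e
    simp only [Finset.coe_product, Set.mem_prod, Finset.mem_coe, Finset.mem_range] at h h'
    simp only [Prod.mk.injEq] at e
    obtain ⟨e1, e2⟩ := e
    have d := hd y h.1 j h.2
    have d' := hd y' h'.1 j' h'.2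
    rw [e2] at d
    have hj : j = j' := by omega
    subst hj
    have hy : y = y' := by
      funext k
      have hk := congrFun e2 k
      by_cases hki : k = i y
      · have b := hi y
        have b' := hi y'
        rw [mem_latSphere.1 h.1] at b
        rw [mem_latSphere.1 h'.1] at b'
        have hki' := hki.trans e1
        rw [← hki] at b hk
        rw [← hki'] at b' hk
        simp only [Function.update_self, c, ← hki, ← hki'] at hk
        have := h.2
        split_ifs at hk <;> omega
      · rw [Function.update_of_ne hki, Function.update_of_ne (e1 ▸ hki)] at hk
        exact hk
    rw [hy]

lemma sum_shift_sub_ge {N : ℕ} (x : Fin N → ℤ) (r : ℕ) (v : (Fin N → ℤ) → ℝ)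
    (hv : ∀ y, 0 ≤ v y) {C : ℝ} (hC : ∀ y, v y ≤ C) (i : Fin N) (c : ℤ) (hc : c.natAbs ≤ 1) :
    -(C * (latSphere N x r).card) ≤
      ∑ y ∈ latBallFinset N x r, v (Function.update y i (y i + c))
        - ∑ y ∈ latBallFinset N x r, v y := by
  set B := latBallFinset N x r with hB
  set B' := B.filter fun y => ¬ latDist x y = r with hB'
  have h1 : ∑ y ∈ latSphere N x r, v y + ∑ y ∈ B', v y = ∑ y ∈ B, v y :=
    Finset.sum_filter_add_sum_filter_not B _ _
  have h2 : ∑ y ∈ latSphere N x r, v y ≤ C * (latSphere N x r).card := by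
    have := Finset.sum_le_card_nsmul (latSphere N x r) v C fun y _ => hC y
    rwa [nsmul_eq_mul, mul_comm] at this
  have hinv : ∀ y : Fin N → ℤ, Function.update (Function.update y i (y i - c)) i
      (Function.update y i (y i - c) i + c) = y := by
    intro y
    simp
  have h3 : ∑ y ∈ B', v y ≤ ∑ y ∈ B, v (Function.update y i (y i + c)) := by
    calc ∑ y ∈ B', v y
        = ∑ z ∈ B'.image (fun y => Function.update y i (y i - c)),
            v (Function.update z i (z i + c)) := by
          rw [Finset.sum_image]
          · exact Finset.sum_congr rfl fun y _ => by rw [hinv]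
          · intro y _ y' _ h
            rw [← hinv y, ← hinv y']
            simp only at h
            rw [h]
      _ ≤ _ := by
          refine Finset.sum_le_sum_of_subset_of_nonneg ?_ fun y _ _ => hv _
          intro z hz
          obtain ⟨y, hy, rfl⟩ := Finset.mem_image.1 hz
          rw [hB', Finset.mem_filter, hB, mem_latBallFinset] at hy
          rw [hB, mem_latBallFinset]
          have := latDist_update x y i (y i - c)
          omega
  linarith

lemma sum_latLap_ge {N : ℕ} (hN : 0 < N) (x : Fin N → ℤ) (r : ℕ) (v : (Fin N → ℤ) → ℝ)
    (hv : ∀ y, 0 ≤ v y) {C : ℝ} (hC : ∀ y, v y ≤ C) :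
    -(2 * C * (latSphere N x r).card) ≤ ∑ y ∈ latBallFinset N x r, latLap N v y := by
  have hN' : (0 : ℝ) < N := Nat.cast_pos.2 hN
  unfold latLap
  rw [← Finset.mul_sum, Finset.sum_comm]
  have h : ∀ i : Fin N, -(2 * C * (latSphere N x r).card) ≤ ∑ y ∈ latBallFinset N x r,
      (v (Function.update y i (y i + 1)) + v (Function.update y i (y i - 1)) - 2 * v y) := by
    intro i
    have h1 := sum_shift_sub_ge x r v hv hC i 1 (by simp)
    have h2 := sum_shift_sub_ge x r v hv hC i (-1) (by simp)
    simp only [← sub_eq_add_neg] at h2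
    rw [Finset.sum_sub_distrib, Finset.sum_add_distrib, ← Finset.mul_sum]
    linarith
  have h3 := Finset.card_nsmul_le_sum Finset.univ _ _ fun i _ => h i
  rw [Finset.card_univ, Fintype.card_fin, nsmul_eq_mul] at h3
  rw [one_div, ← div_eq_inv_mul, le_div_iff₀ hN', mul_comm]
  exact h3

/-- Blow-up bound for the differential inequality `J' ≥ J^p - η a^p` with `J(0) > a`. -/
lemma blowup_time_le {J J' : ℝ → ℝ} {a p η τ : ℝ} (ha : 0 < a) (hp : 1 < p)
    (hη0 : 0 ≤ η) (hη : η < 1) (hτ : 0 < τ) (hc : ContinuousOn J (Icc 0 τ))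
    (hJ : ∀ t ∈ Ioc 0 τ, HasDerivAt J (J' t) t)
    (hJ' : ∀ t ∈ Ioc 0 τ, J t ^ p - η * a ^ p ≤ J' t) (h0 : a < J 0) :
    (p - 1) * (1 - η) * τ ≤ a ^ (1 - p) := by
  have hap : 0 < a ^ p := Real.rpow_pos_of_pos ha p
  have main : ∀ s ∈ Ioo 0 τ, a < J s → (p - 1) * (1 - η) * (τ - s) ≤ a ^ (1 - p) := by
    intro s hs has
    have hmem : ∀ t ∈ Icc s τ, t ∈ Ioc 0 τ := fun t ht => ⟨hs.1.trans_le ht.1, ht.2⟩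
    have hge : ∀ t ∈ Icc s τ, a ≤ J t := by
      have := image_le_of_deriv_right_lt_deriv_boundary' (f := fun t => -J t)
        (f' := fun t => -J' t) (a := s) (b := τ) (B := fun _ => -a) (B' := fun _ => 0)
        (fun t ht => (hJ t (hmem t ht)).continuousAt.continuousWithinAt.neg)
        (fun t ht => (hJ t (hmem t ⟨ht.1, ht.2.le⟩)).neg.hasDerivWithinAt)
        (by simpa using has.le) continuousOn_const
        (fun t _ => hasDerivWithinAt_const _ _ _)
        (fun t ht h => by
          have h1 := hJ' t (hmem t ⟨ht.1, ht.2.le⟩)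
          have h2 : J t = a := neg_injective h
          rw [h2] at h1
          have : 0 < (1 - η) * a ^ p := mul_pos (by linarith) hap
          linarith)
      intro t ht
      have h := this ht
      linarith
    have hpos : ∀ t ∈ Icc s τ, 0 < J t := fun t ht => ha.trans_le (hge t ht)
    have hd : ∀ t ∈ Icc s τ, HasDerivAt (fun t => J t ^ (1 - p))
        (J' t * (1 - p) * J t ^ (1 - p - 1)) t := fun t ht =>
      (hJ t (hmem t ht)).rpow_const (Or.inl (hpos t ht).ne')
    have hdle : ∀ t ∈ Icc s τ,
        J' t * (1 - p) * J t ^ (1 - p - 1) ≤ -((p - 1) * (1 - η)) := by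
      intro t ht
      have h1 := hJ' t (hmem t ht)
      have h2 : a ^ p ≤ J t ^ p := Real.rpow_le_rpow ha.le (hge t ht) (by linarith)
      have h5 : J t ^ (1 - p - 1) = (J t ^ p)⁻¹ := by
        rw [← Real.rpow_neg (hpos t ht).le]
        congr 1
        ring
      have h6 : 0 < J t ^ p := hap.trans_le h2
      have h7 : (1 - η) ≤ J' t * (J t ^ p)⁻¹ := by
        rw [← div_eq_mul_inv, le_div_iff₀ h6]
        have := mul_le_mul_of_nonneg_left h2 hη0
        linarith
      rw [h5]
      nlinarith
    have := (convex_Icc s τ).image_sub_le_mul_sub_of_deriv_le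
      (f := fun t => J t ^ (1 - p)) (C := -((p - 1) * (1 - η)))
      (fun t ht => (hd t ht).continuousAt.continuousWithinAt)
      (fun t ht => (hd t (interior_subset ht)).differentiableAt.differentiableWithinAt)
      (fun t ht => by
        rw [(hd t (interior_subset ht)).deriv]
        exact hdle t (interior_subset ht))
      s (left_mem_Icc.2 hs.2.le) τ (right_mem_Icc.2 hs.2.le) hs.2.le
    have h1 : 0 < J τ ^ (1 - p) := Real.rpow_pos_of_pos (hpos τ (right_mem_Icc.2 hs.2.le)) _
    have h2 : J s ^ (1 - p) ≤ a ^ (1 - p) :=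
      Real.rpow_le_rpow_of_nonpos ha has.le (by linarith)
    linarith
  have hlim : Tendsto (fun s : ℝ => (p - 1) * (1 - η) * (τ - s)) (𝓝[>] 0)
      (𝓝 ((p - 1) * (1 - η) * (τ - 0))) :=
    ((continuous_const.mul (continuous_const.sub continuous_id)).tendsto 0).mono_left
      nhdsWithin_le_nhds
  rw [sub_zero] at hlim
  refine le_of_tendsto hlim ?_
  have hJ0 : ∀ᶠ s in 𝓝[>] (0 : ℝ), a < J s := by
    have h := (hc 0 (left_mem_Icc.2 hτ.le)).eventually (lt_mem_nhds h0)
    rw [nhdsWithin_Icc_eq_nhdsGE hτ] at h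
    exact h.filter_mono (nhdsWithin_mono _ Ioi_subset_Ici_self)
  filter_upwards [hJ0, Ioo_mem_nhdsGT hτ] with s h1 h2 using main s h2 h1

lemma exists_ball_average_gt {N : ℕ} {ψ : (Fin N → ℤ) → ℝ} (hψ0 : ∀ x, 0 ≤ ψ x) {β d : ℝ}
    (hβ : 0 < β) (hd : d < densityDbar N ψ β) (R : ℕ) :
    ∃ r ≥ R, ∃ x, β * d < (∑ y ∈ latBallFinset N x r, ψ y) / (latBallFinset N x r).card := by
  have hbdd : IsCoboundedUnder (· ≤ ·) atTop (fun r : ℕ => densityD N ψ β r) :=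
    IsCoboundedUnder.of_frequently_ge (a := 0) (Frequently.of_forall fun r =>
      Real.iSup_nonneg fun x => by positivity)
  obtain ⟨r, hrR, hr⟩ := ((frequently_lt_of_lt_limsup hbdd hd).and_eventually
    (eventually_ge_atTop R)).exists.imp fun r h => And.intro h.2 h.1
  obtain ⟨x, hx⟩ := exists_lt_of_lt_ciSup hr
  refine ⟨r, hrR, x, ?_⟩
  set B := latBallFinset N x r with hB
  have hBpos : (0 : ℝ) < B.card := Nat.cast_pos.2 (card_latBallFinset_pos N x r)
  have h1 : Nat.card (latBall N x r) = B.card :=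
    Nat.card_eq_card_finite_toFinset (latBall_finite N x r)
  have h2 : Nat.card {y | y ∈ latBall N x r ∧ β ≤ ψ y} = (B.filter fun y => β ≤ ψ y).card := by
    rw [← Nat.card_eq_finsetCard]
    refine Nat.card_congr (Equiv.subtypeEquivRight fun y => ?_)
    simp [hB, latBallFinset]
  rw [h1, h2, lt_div_iff₀ hBpos] at hx
  rw [lt_div_iff₀ hBpos, mul_assoc]
  refine (mul_lt_mul_of_pos_left hx hβ).trans_le ?_
  calc β * ((B.filter fun y => β ≤ ψ y).card : ℝ)
      = (B.filter fun y => β ≤ ψ y).card • β := by rw [nsmul_eq_mul, mul_comm]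
    _ ≤ ∑ y ∈ B.filter (fun y => β ≤ ψ y), ψ y :=
        Finset.card_nsmul_le_sum _ _ _ fun y hy => (Finset.mem_filter.1 hy).2
    _ ≤ ∑ y ∈ B, ψ y :=
        Finset.sum_le_sum_of_subset_of_nonneg (Finset.filter_subset _ _) fun y _ _ => hψ0 y

lemma heatSol_time_le {N : ℕ} (hN : 0 < N) {p : ℝ} (hp : 1 < p) {ψ : (Fin N → ℤ) → ℝ}
    (hψ0 : ∀ x, 0 ≤ ψ x) {β : ℝ} (hβ : 0 < β) {T : ℝ} {u : (Fin N → ℤ) → ℝ → ℝ}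
    (hu : IsHeatSol (latLap N) p ψ T u) {τ : ℝ} (hτ : τ ∈ Ioo 0 T) {d η : ℝ} (hd0 : 0 < d)
    (hd : d < densityDbar N ψ β) (hη0 : 0 < η) (hη : η < 1) :
    (p - 1) * (1 - η) * τ ≤ (β * d) ^ (1 - p) := by
  obtain ⟨C, hC⟩ := hu.bounded τ hτ
  have hC0 : 0 ≤ C := (abs_nonneg _).trans (hC 0 0 ⟨le_rfl, hτ.1.le⟩)
  have ha : 0 < β * d := mul_pos hβ hd0
  have hap : 0 < η * (β * d) ^ p := mul_pos hη0 (Real.rpow_pos_of_pos ha p)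
  obtain ⟨M, hM⟩ := exists_nat_gt (2 * C * N / (η * (β * d) ^ p))
  obtain ⟨r, hr, x, hx⟩ := exists_ball_average_gt hψ0 hβ hd (N * (M + 1))
  set B := latBallFinset N x r with hB
  have hBpos : (0 : ℝ) < B.card := Nat.cast_pos.2 (card_latBallFinset_pos N x r)
  have hsph : 2 * C * (latSphere N x r).card ≤ η * (β * d) ^ p * B.card := by
    have h1 : M + 1 ≤ r / N := (Nat.le_div_iff_mul_le hN).2 (by rw [mul_comm]; exact hr)
    have h2 : (latSphere N x r).card * (M + 1) ≤ N * B.card :=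
      (Nat.mul_le_mul_left _ h1).trans (card_latSphere_mul_le hN x r)
    have h3 : ((latSphere N x r).card : ℝ) * (M + 1) ≤ N * B.card := by exact_mod_cast h2
    rw [div_lt_iff₀ hap] at hM
    have hM0 : (0 : ℝ) < M + 1 := by positivity
    refine le_of_mul_le_mul_right ?_ hM0
    calc 2 * C * (latSphere N x r).card * ((M : ℝ) + 1)
        = 2 * C * ((latSphere N x r).card * ((M : ℝ) + 1)) := by ring
      _ ≤ 2 * C * (N * B.card) := by gcongr
      _ = 2 * C * N * B.card := by ring
      _ ≤ ((M + 1) * (η * (β * d) ^ p)) * B.card := by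
          refine mul_le_mul_of_nonneg_right ?_ hBpos.le
          linarith
      _ = _ := by ring
  refine blowup_time_le (J := fun t => (∑ y ∈ B, u y t) / B.card)
    (J' := fun t => (∑ y ∈ B, (latLap N (fun z => u z t) y + u y t ^ p)) / B.card)
    ha hp hη0.le hη hτ.1 ?_ ?_ ?_ ?_
  · refine ContinuousOn.div_const (continuousOn_finsetSum _ fun y _ => ?_) _
    exact (hu.cont y).mono fun t ht => ⟨ht.1, ht.2.trans_lt hτ.2⟩
  · intro t ht
    exact (HasDerivAt.fun_sum fun y _ => hu.eqn y t ⟨ht.1, ht.2.trans_lt hτ.2⟩).div_const _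
  · intro t ht
    have hn : ∀ y, 0 ≤ u y t := fun y => hu.nonneg y t ⟨ht.1.le, ht.2.trans_lt hτ.2⟩
    have h1 := sum_latLap_ge hN x r (fun z => u z t) hn
      (fun y => (le_abs_self _).trans (hC y t ⟨ht.1.le, ht.2⟩))
    have h2 := Real.rpow_arith_mean_le_arith_mean_rpow B (fun _ => (B.card : ℝ)⁻¹)
      (fun y => u y t) (fun _ _ => by positivity)
      (by rw [Finset.sum_const, nsmul_eq_mul, mul_inv_cancel₀ hBpos.ne'])
      (fun y _ => hn y) hp.le
    rw [← Finset.mul_sum, ← Finset.mul_sum, ← div_eq_inv_mul, ← div_eq_inv_mul] at h2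
    rw [Finset.sum_add_distrib, add_div]
    have h3 : -(η * (β * d) ^ p) ≤ (∑ y ∈ B, latLap N (fun z => u z t) y) / B.card := by
      rw [le_div_iff₀ hBpos]
      linarith
    linarith
  · simpa only [hu.init] using hx

/-- Lemma 6.2: for the equation `u_t = Δ_{ℤ^N} u + u^p` with bounded initial
datum `ψ ≥ 0`, `ψ ≢ 0`, if `D̄(β) > 0` for some `β > 0`, then the life span
satisfies `T₁ ≤ (1/(p-1)) (β D̄(β))^{1-p}`. -/
theorem stmt19 (N : ℕ) (hN : 0 < N) (p : ℝ) (hp : 1 < p)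
    (ψ : (Fin N → ℤ) → ℝ) (hψ0 : ∀ x, 0 ≤ ψ x) (hψbd : ∃ C : ℝ, ∀ x, ψ x ≤ C)
    (hψne : ∃ x, ψ x ≠ 0)
    (β : ℝ) (hβ : 0 < β) (hDbar : 0 < densityDbar N ψ β) :
    lifeSpan (latLap N) p ψ ≤
      ENNReal.ofReal (1 / (p - 1) * (β * densityDbar N ψ β) ^ (1 - p)) := by
  set D := densityDbar N ψ β with hD
  refine iSup₂_le fun T hT => ENNReal.ofReal_le_ofReal ?_
  obtain ⟨hT0, u, hu⟩ := hT
  have hp1 : 0 < p - 1 := by linarith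
  have h1 : ∀ τ ∈ Ioo 0 T, ∀ d ∈ Ioo 0 D, (p - 1) * τ ≤ (β * d) ^ (1 - p) := by
    intro τ hτ d hd
    have hlim : Tendsto (fun η : ℝ => (p - 1) * (1 - η) * τ) (𝓝[>] 0)
        (𝓝 ((p - 1) * (1 - 0) * τ)) :=
      ((by fun_prop : Continuous fun η : ℝ => (p - 1) * (1 - η) * τ).tendsto 0).mono_left
        nhdsWithin_le_nhds
    rw [sub_zero, mul_one] at hlim
    refine le_of_tendsto hlim ?_
    filter_upwards [Ioo_mem_nhdsGT one_pos] with η hη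
    exact heatSol_time_le hN hp hψ0 hβ hu hτ hd.1 hd.2 hη.1 hη.2
  have h2 : ∀ τ ∈ Ioo 0 T, (p - 1) * τ ≤ (β * D) ^ (1 - p) := by
    intro τ hτ
    have hlim : Tendsto (fun d : ℝ => (β * d) ^ (1 - p)) (𝓝[<] D) (𝓝 ((β * D) ^ (1 - p))) :=
      ((continuous_const.mul continuous_id).continuousAt.rpow_const
        (Or.inl (mul_pos hβ hDbar).ne')).tendsto.mono_left nhdsWithin_le_nhds
    refine ge_of_tendsto hlim ?_
    filter_upwards [Ioo_mem_nhdsLT hDbar] with d hd using h1 τ hτ d hd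
  rw [one_div, ← div_eq_inv_mul, le_div_iff₀ hp1, mul_comm]
  have hlim : Tendsto (fun τ : ℝ => (p - 1) * τ) (𝓝[<] T) (𝓝 ((p - 1) * T)) :=
    ((continuous_const.mul continuous_id).tendsto T).mono_left nhdsWithin_le_nhds
  refine le_of_tendsto hlim ?_
  filter_upwards [Ioo_mem_nhdsLT hT0] with τ hτ using h2 τ hτ
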